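/- Let (Ω, 𝓕, P) be a probability space (P countably additive) satisfying the atomless divisibility property: for every measurable E and every real μ with 0 < μ < P(E), there exists a measurable A ⊆ E with P(A) = μ. Let B denote the set of bounded measurable functions X : Ω → ℝ and let I : B → ℝ. Then the following are equivalent: (1) I is normalized (I(0) = 0, I(1) = 1 for constant functions), monotone (X ≥ Y pointwise implies I(X) ≥ I(Y)), law-based (if X, Y ∈ B induce the same pushforward measure X_*P = Y_*P on ℝ, then I(X) = I(Y)), and antimonotonically additive; (2) I(X) = ∫ X dP for all X ∈ B. -/

import Mathlib

open MeasureTheory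

/-- Two functions `X, Y : Ω → ℝ` are comonotonic if
`(X ω - X ω') * (Y ω - Y ω') ≥ 0` for all `ω, ω'`. -/
def Comonotonic {Ω : Type*} (X Y : Ω → ℝ) : Prop :=
  ∀ ω ω' : Ω, (X ω - X ω') * (Y ω - Y ω') ≥ 0

/-- `X` and `Y` are antimonotonic if `X` and `-Y` are comonotonic. -/
def Antimonotonic {Ω : Type*} (X Y : Ω → ℝ) : Prop :=
  Comonotonic X (-Y)

/-- The set of bounded measurable real-valued functions on `Ω`. -/
def BddMeas (Ω : Type*) [MeasurableSpace Ω] : Set (Ω → ℝ) :=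
  {X | Measurable X ∧ ∃ M : ℝ, ∀ ω, |X ω| ≤ M}

/-- A nonnegative function that is additive on `[0, 1]` is linear there. -/
theorem eq_mul_of_additive_of_nonneg {f : ℝ → ℝ}
    (hadd : ∀ p q, 0 ≤ p → 0 ≤ q → p + q ≤ 1 → f (p + q) = f p + f q)
    (hnn : ∀ p, 0 ≤ p → p ≤ 1 → 0 ≤ f p) {p : ℝ} (hp0 : 0 ≤ p) (hp1 : p ≤ 1) :
    f p = p * f 1 := by
  have hmono : ∀ p q, 0 ≤ p → p ≤ q → q ≤ 1 → f p ≤ f q := by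
    intro p q hp hpq hq
    have h := hadd p (q - p) hp (by linarith) (by linarith)
    rw [add_sub_cancel] at h
    linarith [hnn (q - p) (by linarith) (by linarith)]
  have hzero : f 0 = 0 := by
    have := hadd 0 0 le_rfl le_rfl (by norm_num)
    rw [add_zero] at this
    linarith
  have hmul : ∀ n : ℕ, 0 < n → ∀ k : ℕ, k ≤ n → f (k / n) = k * f (1 / n) := by
    intro n hn k
    have hn' : (0 : ℝ) < n := by exact_mod_cast hn
    induction k with
    | zero => intro _; simp [hzero]
    | succ k ih =>
      intro hk
      have hk' : (k : ℝ) + 1 ≤ n := by exact_mod_cast hk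
      have h := hadd (k / n) (1 / n) (by positivity) (by positivity)
        (by rw [← add_div, div_le_one hn']; exact hk')
      rw [← add_div, ih (by omega)] at h
      push_cast
      rw [h]
      ring
  have hrat : ∀ n : ℕ, 0 < n → ∀ k : ℕ, k ≤ n → f (k / n) = k / n * f 1 := by
    intro n hn k hk
    have hn' : (0 : ℝ) < n := by exact_mod_cast hn
    have h := hmul n hn n le_rfl
    rw [div_self hn'.ne'] at h
    rw [hmul n hn k hk, h]
    field_simp
  have hf1 : 0 ≤ f 1 := hnn 1 zero_le_one le_rfl
  rcases hp1.eq_or_lt with rfl | hlt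
  · rw [one_mul]
  have hbound : ∀ n : ℕ, 0 < n → |f p - p * f 1| ≤ f 1 / n := by
    intro n hn
    have hn' : (0 : ℝ) < n := by exact_mod_cast hn
    set k := ⌊(n : ℝ) * p⌋₊ with hk
    have hk1 : (k : ℝ) ≤ n * p := Nat.floor_le (by positivity)
    have hk2 : (n : ℝ) * p < k + 1 := Nat.lt_floor_add_one _
    have hkn : k < n := by
      have : (k : ℝ) < n := by nlinarith
      exact_mod_cast this
    have hkn' : ((k + 1 : ℕ) : ℝ) ≤ n := by exact_mod_cast hkn
    have hl : (k : ℝ) / n ≤ p := by rw [div_le_iff₀ hn']; linarith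
    have hu : p ≤ ((k + 1 : ℕ) : ℝ) / n := by
      rw [le_div_iff₀ hn']; push_cast; linarith
    have h1 := hmono _ _ (by positivity) hl hp1
    have h2 := hmono _ _ hp0 hu (by rw [div_le_one hn']; exact hkn')
    rw [hrat n hn k hkn.le] at h1
    rw [hrat n hn (k + 1) hkn] at h2
    have e : ((k + 1 : ℕ) : ℝ) / n = k / n + 1 / n := by push_cast; ring
    rw [e] at h2 hu
    have e2 : f 1 / n = 1 / n * f 1 := by ring
    rw [abs_le, e2]
    constructor <;> nlinarith
  have hlim : Filter.Tendsto (fun n : ℕ => f 1 / n) Filter.atTop (nhds 0) :=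
    tendsto_const_div_atTop_nhds_zero_nat _
  have hle : |f p - p * f 1| ≤ 0 := ge_of_tendsto hlim
    ((Filter.eventually_gt_atTop 0).mono hbound)
  exact sub_eq_zero.mp (abs_nonpos_iff.mp hle)

theorem antimonotonic_const {Ω : Type*} (X : Ω → ℝ) (c : ℝ) :
    Antimonotonic X (fun _ => c) := by
  intro ω ω'
  simp

/-- Nonnegative functions that are never simultaneously nonzero are antimonotonic. -/
theorem antimonotonic_of_mul_eq_zero {Ω : Type*} {X Y : Ω → ℝ} (hX : ∀ ω, 0 ≤ X ω)
    (hY : ∀ ω, 0 ≤ Y ω) (h : ∀ ω, X ω * Y ω = 0) : Antimonotonic X Y := by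
  intro ω ω'
  simp only [Pi.neg_apply]
  nlinarith [h ω, h ω', mul_nonneg (hX ω) (hY ω'), mul_nonneg (hX ω') (hY ω)]

theorem const_mem_bddMeas {Ω : Type*} [MeasurableSpace Ω] (c : ℝ) :
    (fun _ => c : Ω → ℝ) ∈ BddMeas Ω :=
  ⟨measurable_const, |c|, fun _ => le_rfl⟩

theorem add_mem_bddMeas {Ω : Type*} [MeasurableSpace Ω] {X Y : Ω → ℝ}
    (hX : X ∈ BddMeas Ω) (hY : Y ∈ BddMeas Ω) : X + Y ∈ BddMeas Ω := by
  obtain ⟨hX, M, hM⟩ := hX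
  obtain ⟨hY, N, hN⟩ := hY
  exact ⟨hX.add hY, M + N, fun ω => (abs_add_le _ _).trans (add_le_add (hM ω) (hN ω))⟩

theorem indicator_mem_bddMeas {Ω : Type*} [MeasurableSpace Ω] {A : Set Ω}
    (hA : MeasurableSet A) (a : ℝ) : A.indicator (fun _ => a) ∈ BddMeas Ω := by
  refine ⟨measurable_const.indicator hA, |a|, fun ω => ?_⟩
  by_cases h : ω ∈ A <;> simp [h]

theorem simpleFunc_mem_bddMeas {Ω : Type*} [MeasurableSpace Ω] (f : SimpleFunc Ω NNReal) :
    (fun ω => (f ω : ℝ)) ∈ BddMeas Ω := by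
  refine ⟨f.measurable.coe_nnreal_real, ?_⟩
  obtain ⟨C, hC⟩ := f.finite_range.bddAbove
  refine ⟨C, fun ω => ?_⟩
  rw [NNReal.abs_eq]
  exact_mod_cast hC (Set.mem_range_self ω)

theorem integrable_of_mem_bddMeas {Ω : Type*} [MeasurableSpace Ω] (P : Measure Ω)
    [IsFiniteMeasure P] {X : Ω → ℝ} (hX : X ∈ BddMeas Ω) : Integrable X P := by
  obtain ⟨hm, M, hM⟩ := hX
  exact Integrable.of_bound hm.aestronglyMeasurable M (Filter.Eventually.of_forall hM)

theorem map_indicator_const_eq {Ω : Type*} [MeasurableSpace Ω] (P : Measure Ω)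
    [IsProbabilityMeasure P] {A B : Set Ω} (hA : MeasurableSet A) (hB : MeasurableSet B)
    (h : P A = P B) (a : ℝ) :
    P.map (A.indicator fun _ => a) = P.map (B.indicator fun _ => a) := by
  classical
  ext s hs
  rw [Measure.map_apply (measurable_const.indicator hA) hs,
    Measure.map_apply (measurable_const.indicator hB) hs,
    Set.indicator_const_preimage_eq_union, Set.indicator_const_preimage_eq_union]
  split_ifs <;> simp [prob_compl_eq_one_sub, hA, hB, h]

/-- A monotone, law-based and antimonotonically additive functional `I` satisfies
`I (a * 1_A) = P A * I a` for every nonnegative constant `a`. -/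
theorem am_law_based_indicator {Ω : Type*} [MeasurableSpace Ω]
    (P : Measure Ω) [IsProbabilityMeasure P]
    (hatomless : ∀ E : Set Ω, MeasurableSet E → ∀ μ : ℝ, 0 < μ →
      ENNReal.ofReal μ < P E →
      ∃ A, A ⊆ E ∧ MeasurableSet A ∧ P A = ENNReal.ofReal μ)
    {I : (Ω → ℝ) → ℝ} (h0 : I 0 = 0)
    (hmono : ∀ X ∈ BddMeas Ω, ∀ Y ∈ BddMeas Ω, (∀ ω, X ω ≥ Y ω) → I X ≥ I Y)
    (hlaw : ∀ X ∈ BddMeas Ω, ∀ Y ∈ BddMeas Ω, P.map X = P.map Y → I X = I Y)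
    (ham : ∀ X ∈ BddMeas Ω, ∀ Y ∈ BddMeas Ω, Antimonotonic X Y → I (X + Y) = I X + I Y)
    {a : ℝ} (ha : 0 ≤ a) {A : Set Ω} (hA : MeasurableSet A) :
    I (A.indicator fun _ => a) = P.real A * I (fun _ => a) := by
  have hex : ∀ E : Set Ω, MeasurableSet E → ∀ μ : ℝ, 0 ≤ μ → μ ≤ P.real E →
      ∃ A, A ⊆ E ∧ MeasurableSet A ∧ P.real A = μ := by
    intro E hE μ hμ hle
    rcases hμ.eq_or_lt with rfl | hpos
    · exact ⟨∅, Set.empty_subset _, MeasurableSet.empty, by simp⟩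
    rcases hle.eq_or_lt with rfl | hlt
    · exact ⟨E, subset_rfl, hE, rfl⟩
    obtain ⟨A, hAE, hA, hPA⟩ := hatomless E hE μ hpos
      (by rwa [ENNReal.ofReal_lt_iff_lt_toReal hμ (measure_ne_top P E)])
    exact ⟨A, hAE, hA, by rw [measureReal_def, hPA, ENNReal.toReal_ofReal hμ]⟩
  have hex' : ∀ p : ℝ, ∃ A, MeasurableSet A ∧ (0 ≤ p → p ≤ 1 → P.real A = p) := by
    intro p
    by_cases hp : 0 ≤ p ∧ p ≤ 1
    · obtain ⟨A, -, hA, hPA⟩ := hex Set.univ MeasurableSet.univ p hp.1 (by simpa using hp.2)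
      exact ⟨A, hA, fun _ _ => hPA⟩
    · exact ⟨∅, MeasurableSet.empty, fun h1 h2 => absurd ⟨h1, h2⟩ hp⟩
  choose S hS hPS using hex'
  have hSlaw : ∀ B : Set Ω, MeasurableSet B →
      I ((S (P.real B)).indicator fun _ => a) = I (B.indicator fun _ => a) := by
    intro B hB
    refine hlaw _ (indicator_mem_bddMeas (hS _) a) _ (indicator_mem_bddMeas hB a)
      (map_indicator_const_eq P (hS _) hB ?_ a)
    exact (measureReal_eq_measureReal_iff).mp (hPS _ measureReal_nonneg measureReal_le_one)
  have key := eq_mul_of_additive_of_nonneg (f := fun p => I ((S p).indicator fun _ => a))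
    (p := P.real A) ?_ ?_ measureReal_nonneg measureReal_le_one
  · have h1 := hSlaw Set.univ MeasurableSet.univ
    simp only [probReal_univ, Set.indicator_univ] at h1
    simpa only [hSlaw A hA, h1] using key
  · intro p q hp hq hpq
    obtain ⟨B, hB, hBm, hPB⟩ := hex (S p)ᶜ (hS p).compl q hq
      (by rw [probReal_compl_eq_one_sub (hS p), hPS p hp (by linarith)]; linarith)
    have hdisj : Disjoint (S p) B := (Set.disjoint_left.2 fun x hx hxB => hB hxB hx)
    have hPU : P.real (S p ∪ B) = p + q := by
      rw [measureReal_union hdisj hBm, hPS p hp (by linarith), hPB]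
    have h1 := hSlaw _ ((hS p).union hBm)
    have h2 := hSlaw _ hBm
    rw [hPU, Set.indicator_union_of_disjoint hdisj] at h1
    rw [hPB] at h2
    rw [h1, h2, ← ham _ (indicator_mem_bddMeas (hS p) a) _ (indicator_mem_bddMeas hBm a)]
    · rfl
    · refine antimonotonic_of_mul_eq_zero (Set.indicator_nonneg fun _ _ => ha)
        (Set.indicator_nonneg fun _ _ => ha) fun ω => ?_
      by_cases hω : ω ∈ S p
      · simp [Set.disjoint_left.1 hdisj hω]
      · simp [hω]
  · intro p _ _
    rw [← h0]
    exact hmono _ (indicator_mem_bddMeas (hS p) a) _ (const_mem_bddMeas 0)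
      (Set.indicator_nonneg fun _ _ => ha)

/-- A normalized, monotone, antimonotonically additive functional fixes the nonnegative
constants. -/
theorem am_const {Ω : Type*} [MeasurableSpace Ω] {I : (Ω → ℝ) → ℝ}
    (h0 : I 0 = 0) (h1 : I 1 = 1)
    (hmono : ∀ X ∈ BddMeas Ω, ∀ Y ∈ BddMeas Ω, (∀ ω, X ω ≥ Y ω) → I X ≥ I Y)
    (ham : ∀ X ∈ BddMeas Ω, ∀ Y ∈ BddMeas Ω, Antimonotonic X Y → I (X + Y) = I X + I Y)
    {c : ℝ} (hc : 0 ≤ c) : I (fun _ => c) = c := by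
  have hadd : ∀ x y : ℝ, I (fun _ => x + y) = I (fun _ => x) + I (fun _ => y) := fun x y =>
    ham _ (const_mem_bddMeas x) _ (const_mem_bddMeas y) (antimonotonic_const _ y)
  have hnat : ∀ n : ℕ, I (fun _ => (n : ℝ)) = n := by
    intro n
    induction n with
    | zero => simpa using (show I (fun _ => (0 : ℝ)) = 0 from h0)
    | succ n ih =>
      push_cast
      rw [hadd, ih]
      exact congrArg _ h1
  obtain ⟨n, hn⟩ := exists_nat_gt c
  have hn0 : (0 : ℝ) < n := hc.trans_lt hn
  have key := eq_mul_of_additive_of_nonneg (f := fun p => I (fun _ => n * p)) (p := c / n)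
    (fun p q _ _ _ => by simp only [mul_add, hadd])
    (fun p hp _ => by
      rw [← h0]
      exact hmono _ (const_mem_bddMeas _) _ (const_mem_bddMeas 0)
        fun _ => mul_nonneg hn0.le hp)
    (by positivity) (by rw [div_le_one hn0]; exact hn.le)
  simp only [mul_one, hnat] at key
  rwa [mul_div_cancel₀ _ hn0.ne', div_mul_cancel₀ _ hn0.ne'] at key

/-- On an atomless probability space, a functional on the bounded measurable
functions is normalized, monotone, law-based, and antimonotonically additive
if and only if it is the expectation with respect to `P`. -/
theorem am_law_based_expectation {Ω : Type*} [MeasurableSpace Ω]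
    (P : Measure Ω) [IsProbabilityMeasure P]
    (hatomless : ∀ E : Set Ω, MeasurableSet E → ∀ μ : ℝ, 0 < μ →
      ENNReal.ofReal μ < P E →
      ∃ A, A ⊆ E ∧ MeasurableSet A ∧ P A = ENNReal.ofReal μ)
    (I : (Ω → ℝ) → ℝ) :
    (I 0 = 0 ∧ I 1 = 1 ∧
     (∀ X ∈ BddMeas Ω, ∀ Y ∈ BddMeas Ω, (∀ ω, X ω ≥ Y ω) → I X ≥ I Y) ∧
     (∀ X ∈ BddMeas Ω, ∀ Y ∈ BddMeas Ω, P.map X = P.map Y → I X = I Y) ∧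
     (∀ X ∈ BddMeas Ω, ∀ Y ∈ BddMeas Ω, Antimonotonic X Y →
       I (X + Y) = I X + I Y)) ↔
    (∀ X ∈ BddMeas Ω, I X = ∫ ω, X ω ∂P) := by
  constructor
  · rintro ⟨h0, h1, hmono, hlaw, ham⟩
    have hconst : ∀ c : ℝ, 0 ≤ c → I (fun _ => c) = c := fun c hc =>
      am_const h0 h1 hmono ham hc
    have hsimple : ∀ f : SimpleFunc Ω NNReal, I (fun ω => (f ω : ℝ)) = ∫ ω, (f ω : ℝ) ∂P := by
      intro f
      induction f using SimpleFunc.induction with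
      | const c hs =>
        rename_i s
        have e : (fun ω => ((SimpleFunc.piecewise s hs (SimpleFunc.const Ω c)
            (SimpleFunc.const Ω 0) ω : NNReal) : ℝ)) = s.indicator fun _ => (c : ℝ) := by
          funext ω
          by_cases hω : ω ∈ s <;> simp [hω]
        rw [e, am_law_based_indicator P hatomless h0 hmono hlaw ham c.coe_nonneg hs,
          hconst _ c.coe_nonneg, integral_indicator_const _ hs, smul_eq_mul]
      | add hd hf hg =>
        rename_i f g
        have hfm := simpleFunc_mem_bddMeas f
        have hgm := simpleFunc_mem_bddMeas g
        have e : (fun ω => (((f + g : SimpleFunc Ω NNReal) ω : NNReal) : ℝ))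
            = (fun ω => (f ω : ℝ)) + fun ω => (g ω : ℝ) := by
          funext ω
          simp
        rw [e, ham _ hfm _ hgm, hf, hg]
        · exact (integral_add (integrable_of_mem_bddMeas P hfm)
            (integrable_of_mem_bddMeas P hgm)).symm
        · refine antimonotonic_of_mul_eq_zero (fun _ => NNReal.coe_nonneg _)
            (fun _ => NNReal.coe_nonneg _) fun ω => ?_
          by_cases hω : f ω = 0
          · simp [hω]
          · have : g ω = 0 := by
              by_contra hgω
              exact Set.disjoint_left.1 hd hω hgω
            simp [this]
    have hnonneg : ∀ X ∈ BddMeas Ω, (∀ ω, 0 ≤ X ω) → I X = ∫ ω, X ω ∂P := by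
      intro X hX hpos
      have hXi := integrable_of_mem_bddMeas P hX
      have hbound : ∀ n : ℕ, 0 < n → |I X - ∫ ω, X ω ∂P| ≤ 1 / n := by
        intro n hn
        have hn' : (0 : ℝ) < n := by exact_mod_cast hn
        obtain ⟨M, hM⟩ := hX.2
        have hmeas : Measurable fun ω => ⌊(n : ℝ) * X ω⌋₊ :=
          Nat.measurable_floor.comp (hX.1.const_mul _)
        have hfin : (Set.range fun ω => ⌊(n : ℝ) * X ω⌋₊).Finite := by
          refine (Set.finite_Iic ⌊(n : ℝ) * M⌋₊).subset ?_
          rintro _ ⟨ω, rfl⟩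
          exact Nat.floor_mono (mul_le_mul_of_nonneg_left ((le_abs_self _).trans (hM ω)) hn'.le)
        let g : SimpleFunc Ω ℕ := ⟨fun ω => ⌊(n : ℝ) * X ω⌋₊,
          fun k => hmeas (measurableSet_singleton k), hfin⟩
        let f : SimpleFunc Ω NNReal := g.map fun k : ℕ => (k : NNReal) / n
        have hf : ∀ ω, (f ω : ℝ) = (⌊(n : ℝ) * X ω⌋₊ : ℝ) / n := by
          intro ω
          simp [f, g]
        have hle : ∀ ω, (f ω : ℝ) ≤ X ω := by
          intro ω
          rw [hf, div_le_iff₀ hn', mul_comm (X ω)]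
          exact Nat.floor_le (mul_nonneg hn'.le (hpos ω))
        have hge : ∀ ω, X ω ≤ (f ω : ℝ) + 1 / n := by
          intro ω
          rw [hf, ← add_div, le_div_iff₀ hn', mul_comm (X ω)]
          exact (Nat.lt_floor_add_one _).le
        have hfm := simpleFunc_mem_bddMeas f
        have hcm := const_mem_bddMeas (Ω := Ω) (1 / (n : ℝ))
        have hfi := integrable_of_mem_bddMeas P hfm
        have i1 : I X ≥ I (fun ω => (f ω : ℝ)) := hmono _ hX _ hfm hle
        have i2 : I ((fun ω => (f ω : ℝ)) + fun _ => 1 / (n : ℝ)) ≥ I X :=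
          hmono _ (add_mem_bddMeas hfm hcm) _ hX hge
        rw [ham _ hfm _ hcm (antimonotonic_const _ _), hconst _ (by positivity), hsimple] at i2
        rw [hsimple] at i1
        have i3 : ∫ ω, (f ω : ℝ) ∂P ≤ ∫ ω, X ω ∂P := integral_mono hfi hXi hle
        have i4 : ∫ ω, X ω ∂P ≤ ∫ ω, ((f ω : ℝ) + 1 / n) ∂P :=
          integral_mono hXi (hfi.add (integrable_const _)) hge
        rw [integral_add hfi (integrable_const _), integral_const, probReal_univ, one_smul] at i4
        rw [abs_le]
        constructor <;> linarith
      have hlim : Filter.Tendsto (fun n : ℕ => 1 / (n : ℝ)) Filter.atTop (nhds 0) :=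
        tendsto_const_div_atTop_nhds_zero_nat _
      have hle : |I X - ∫ ω, X ω ∂P| ≤ 0 := ge_of_tendsto hlim
        ((Filter.eventually_gt_atTop 0).mono hbound)
      exact sub_eq_zero.mp (abs_nonpos_iff.mp hle)
    intro X hX
    obtain ⟨M, hM⟩ := hX.2
    have hcm := const_mem_bddMeas (Ω := Ω) |M|
    have h := hnonneg _ (add_mem_bddMeas hX hcm) fun ω => by
      have := neg_abs_le (X ω)
      have := hM ω
      have := le_abs_self M
      simp only [Pi.add_apply]
      linarith
    rw [ham _ hX _ hcm (antimonotonic_const _ _), hconst _ (abs_nonneg _)] at h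
    simp only [Pi.add_apply] at h
    rw [integral_add (integrable_of_mem_bddMeas P hX) (integrable_const _), integral_const,
      probReal_univ, one_smul] at h
    linarith
  · intro h
    refine ⟨?_, ?_, ?_, ?_, ?_⟩
    · rw [h 0 (const_mem_bddMeas 0)]
      simp
    · rw [h 1 (const_mem_bddMeas 1)]
      simp
    · intro X hX Y hY hXY
      rw [h X hX, h Y hY]
      exact integral_mono (integrable_of_mem_bddMeas P hY) (integrable_of_mem_bddMeas P hX) hXY
    · intro X hX Y hY hXY
      rw [h X hX, h Y hY]
      have e : ∀ Z : Ω → ℝ, Measurable Z → ∫ ω, Z ω ∂P = ∫ x, x ∂P.map Z := fun Z hZ =>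
        (integral_map hZ.aemeasurable aestronglyMeasurable_id).symm
      rw [e X hX.1, e Y hY.1, hXY]
    · intro X hX Y hY _
      rw [h X hX, h Y hY, h _ (add_mem_bddMeas hX hY)]
      exact integral_add (integrable_of_mem_bddMeas P hX) (integrable_of_mem_bddMeas P hY)
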